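/- Assume Γ is Q-polynomial with respect to E. Then for all distinct vertices x, y ∈ X: C(x,y) = C(y,x) and B(x,y) = B(y,x). -/

import Mathlib

open Matrix Finset
open scoped Classical

/-- A distance-regular graph `Γ` with vertex set `X`, path-length distance
`G.dist`, diameter `d ≥ 2`, and intersection numbers `p h i j`. -/
structure DRG where
  X : Type
  [fin : Fintype X]
  [deceq : DecidableEq X]
  G : SimpleGraph X
  conn : G.Connected
  d : ℕ
  d_ge_two : 2 ≤ d
  dist_le : ∀ x y : X, G.dist x y ≤ d
  dist_attained : ∃ x y : X, G.dist x y = d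
  p : ℕ → ℕ → ℕ → ℕ
  dist_regular : ∀ (h i j : ℕ) (x y : X), G.dist x y = h →
    (Finset.univ.filter fun z => G.dist x z = i ∧ G.dist y z = j).card = p h i j

attribute [instance] DRG.fin DRG.deceq

namespace DRG

variable (Γ : DRG)

/-- `Γ_i(x) = {z : ∂(x,z) = i}`. -/
noncomputable def sphere (x : Γ.X) (i : ℕ) : Finset Γ.X :=
  Finset.univ.filter fun z => Γ.G.dist x z = i

/-- The number of vertices `|X|`, as a real number. -/
noncomputable def n : ℝ := (Fintype.card Γ.X : ℝ)

/-- The `i`-th distance matrix `A_i`. -/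
noncomputable def Ai (i : ℕ) : Matrix Γ.X Γ.X ℝ :=
  Matrix.of fun x y => if Γ.G.dist x y = i then (1 : ℝ) else 0

/-- The adjacency matrix `A = A_1`. -/
noncomputable def A : Matrix Γ.X Γ.X ℝ := Γ.Ai 1

/-- The all-ones matrix `J`. -/
def Jmat : Matrix Γ.X Γ.X ℝ := Matrix.of fun _ _ => (1 : ℝ)

/-- `c_i = p^i_{1,i-1}` (so `c_0 = 0`). -/
noncomputable def c (i : ℕ) : ℝ := (Γ.p i 1 (i - 1) : ℝ)

/-- `a_i = p^i_{1,i}`. -/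
noncomputable def a (i : ℕ) : ℝ := (Γ.p i 1 i : ℝ)

/-- `b_i = p^i_{1,i+1}` (so `b_d = 0`). -/
noncomputable def b (i : ℕ) : ℝ := (Γ.p i 1 (i + 1) : ℝ)

/-- The standard basis vector `x̂`. -/
noncomputable def hatv (x : Γ.X) : Γ.X → ℝ := Pi.single x 1

/-- `x⁺_y = Σ_{z ∈ Γ(x) ∩ Γ_{i+1}(y)} ẑ` where `i = ∂(x,y)`. -/
noncomputable def plusv (x y : Γ.X) : Γ.X → ℝ :=
  ∑ z ∈ Γ.sphere x 1 ∩ Γ.sphere y (Γ.G.dist x y + 1), Γ.hatv z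

/-- `x⁰_y = Σ_{z ∈ Γ(x) ∩ Γ_i(y)} ẑ` where `i = ∂(x,y)`. -/
noncomputable def zerov (x y : Γ.X) : Γ.X → ℝ :=
  ∑ z ∈ Γ.sphere x 1 ∩ Γ.sphere y (Γ.G.dist x y), Γ.hatv z

/-- `x⁻_y = Σ_{z ∈ Γ(x) ∩ Γ_{i-1}(y)} ẑ` where `i = ∂(x,y)`
(for `i = 0` this is the zero vector, matching `Γ_{-1}(y) = ∅`). -/
noncomputable def minusv (x y : Γ.X) : Γ.X → ℝ :=
  ∑ z ∈ Γ.sphere x 1 ∩ Γ.sphere y (Γ.G.dist x y - 1), Γ.hatv z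

/-- The Norton product `u ⋆ v = E (u ∘ v)`, where `∘` is the entrywise
(Hadamard) product of vectors. -/
noncomputable def norton (E : Matrix Γ.X Γ.X ℝ) (u v : Γ.X → ℝ) : Γ.X → ℝ :=
  E *ᵥ (u * v)

/-- `E 0, …, E d` is the sequence of primitive idempotents of the Bose–Mesner
algebra, with `E 0 = |X|⁻¹ J`, and `θ 0, …, θ d` are the corresponding
(mutually distinct) eigenvalues, so that `A = Σ_i θ i • E i`. -/
def IsPrimIdemSeq (E : ℕ → Matrix Γ.X Γ.X ℝ) (θ : ℕ → ℝ) : Prop :=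
  E 0 = (Γ.n)⁻¹ • Γ.Jmat ∧
  ∑ i ∈ Finset.range (Γ.d + 1), E i = 1 ∧
  (∀ i j : ℕ, i ≤ Γ.d → j ≤ Γ.d → E i * E j = if i = j then E i else 0) ∧
  Γ.A = ∑ i ∈ Finset.range (Γ.d + 1), θ i • E i ∧
  (∀ i j : ℕ, i ≤ Γ.d → j ≤ Γ.d → θ i = θ j → i = j)

/-- `q h i j` are the Krein parameters:
`E i ∘ E j = |X|⁻¹ Σ_h q h i j • E h`, with `∘` the entrywise product. -/
def IsKrein (E : ℕ → Matrix Γ.X Γ.X ℝ) (q : ℕ → ℕ → ℕ → ℝ) : Prop :=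
  ∀ i j : ℕ, i ≤ Γ.d → j ≤ Γ.d →
    Matrix.hadamard (E i) (E j) =
      (Γ.n)⁻¹ • ∑ h ∈ Finset.range (Γ.d + 1), q h i j • E h

/-- The ordering `E 1, …, E d` is `Q`-polynomial: for `0 ≤ h,i,j ≤ d`,
`q h i j = 0` if one of `h,i,j` is greater than the sum of the other two, and
`q h i j ≠ 0` if one of `h,i,j` equals the sum of the other two. -/
def IsQPolynomial (q : ℕ → ℕ → ℕ → ℝ) : Prop :=
  ∀ h i j : ℕ, h ≤ Γ.d → i ≤ Γ.d → j ≤ Γ.d →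
    ((i + j < h ∨ h + j < i ∨ h + i < j) → q h i j = 0) ∧
    ((h = i + j ∨ i = h + j ∨ j = h + i) → q h i j ≠ 0)

/-- `ts 0, …, ts d` are the (mutually distinct) dual eigenvalues associated
with `E`, i.e. `E = |X|⁻¹ Σ_i ts i • A i`.  The values `ts (-1)` and
`ts (d+1)` are arbitrary reals (indeterminates). -/
def IsDualEigs (E : Matrix Γ.X Γ.X ℝ) (ts : ℤ → ℝ) : Prop :=
  E = (Γ.n)⁻¹ • ∑ i ∈ Finset.range (Γ.d + 1), ts i • Γ.Ai i

/-- The dual eigenvalues `ts 0, …, ts d` are mutually distinct. -/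
def DualDistinct (ts : ℤ → ℝ) : Prop :=
  ∀ i j : ℕ, i ≤ Γ.d → j ≤ Γ.d → ts i = ts j → i = j

/-- `C(x,y) = E x⁻_y − c_i ((θ*_1 − θ*_{i-1})/(θ*_0 − θ*_i)) E x̂`,
where `i = ∂(x,y)`. -/
noncomputable def Cvec (E : Matrix Γ.X Γ.X ℝ) (ts : ℤ → ℝ) (x y : Γ.X) :
    Γ.X → ℝ :=
  E *ᵥ Γ.minusv x y -
    (Γ.c (Γ.G.dist x y) *
      ((ts 1 - ts ((Γ.G.dist x y : ℤ) - 1)) / (ts 0 - ts (Γ.G.dist x y)))) •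
      (E *ᵥ Γ.hatv x)

/-- `B(x,y) = E x⁺_y − b_i ((θ*_1 − θ*_{i+1})/(θ*_0 − θ*_i)) E x̂`,
where `i = ∂(x,y)`. -/
noncomputable def Bvec (E : Matrix Γ.X Γ.X ℝ) (ts : ℤ → ℝ) (x y : Γ.X) :
    Γ.X → ℝ :=
  E *ᵥ Γ.plusv x y -
    (Γ.b (Γ.G.dist x y) *
      ((ts 1 - ts ((Γ.G.dist x y : ℤ) + 1)) / (ts 0 - ts (Γ.G.dist x y)))) •
      (E *ᵥ Γ.hatv x)

end DRG

namespace DRG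

section Idempotents

variable {X : Type*} [Fintype X] [DecidableEq X]

/-- Orthogonal idempotents summing to `1` that diagonalise a symmetric matrix with distinct
eigenvalues are symmetric. -/
theorem transpose_eq_self_of_eigen {d : ℕ} {A : Matrix X X ℝ} {E : ℕ → Matrix X X ℝ} {θ : ℕ → ℝ}
    (hA : Aᵀ = A) (hsum : ∑ i ∈ Finset.range (d + 1), E i = 1)
    (hmul : ∀ i j : ℕ, i ≤ d → j ≤ d → E i * E j = if i = j then E i else 0)
    (hAE : A = ∑ i ∈ Finset.range (d + 1), θ i • E i)
    (hθ : ∀ i j : ℕ, i ≤ d → j ≤ d → θ i = θ j → i = j) {k : ℕ} (hk : k ≤ d) :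
    (E k)ᵀ = E k := by
  have hmulA : ∀ j ≤ d, A * E j = θ j • E j := by
    intro j hj
    rw [hAE, Finset.sum_mul, Finset.sum_eq_single j]
    · rw [smul_mul_assoc, hmul j j hj hj, if_pos rfl]
    · intro i hi hij
      rw [smul_mul_assoc, hmul i j (by simpa [Nat.lt_succ_iff] using hi) hj, if_neg hij, smul_zero]
    · intro h
      exact absurd (Finset.mem_range.2 (Nat.lt_succ_of_le hj)) h
  have hzero : ∀ j ≤ d, j ≠ k → (E k)ᵀ * E j = 0 := by
    intro j hj hjk
    have h1 : (E k)ᵀ * A = θ k • (E k)ᵀ := by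
      rw [← Matrix.transpose_smul, ← hmulA k hk, Matrix.transpose_mul, hA]
    have h2 : θ k • ((E k)ᵀ * E j) = θ j • ((E k)ᵀ * E j) := by
      rw [← smul_mul_assoc, ← h1, Matrix.mul_assoc, hmulA j hj, mul_smul_comm]
    have h3 : (θ k - θ j) • ((E k)ᵀ * E j) = 0 := by rw [sub_smul, h2, sub_self]
    exact (smul_eq_zero.1 h3).resolve_left fun h =>
      hjk (hθ j k hj hk (sub_eq_zero.1 h).symm)
  have hself : (E k)ᵀ = (E k)ᵀ * E k := by
    conv_lhs => rw [← Matrix.mul_one (E k)ᵀ, ← hsum, Finset.mul_sum]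
    rw [Finset.sum_eq_single k]
    · intro j hj hjk
      exact hzero j (by simpa [Nat.lt_succ_iff] using hj) hjk
    · intro h
      exact absurd (Finset.mem_range.2 (Nat.lt_succ_of_le hk)) h
  have h := congrArg Matrix.transpose hself
  rw [Matrix.transpose_mul, Matrix.transpose_transpose, ← hself] at h
  exact h.symm

/-- If `D` is tridiagonal with respect to the resolution of identity `E 0, …, E d`, then
`E i * D * E (i + 1) - E (i + 1) * D * E i` is the commutator of `E 0 + ⋯ + E i` and `D`. -/
theorem adjacent_skew_eq_commutator {d : ℕ} {E : ℕ → Matrix X X ℝ} {D : Matrix X X ℝ}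
    (hsum : ∑ i ∈ Finset.range (d + 1), E i = 1)
    (hD : ∀ i j : ℕ, i ≤ d → j ≤ d → (i + 1 < j ∨ j + 1 < i) → E i * D * E j = 0)
    {i : ℕ} (hi : i + 1 ≤ d) :
    E i * D * E (i + 1) - E (i + 1) * D * E i =
      (∑ k ∈ Finset.range (i + 1), E k) * D - D * ∑ k ∈ Finset.range (i + 1), E k := by
  set P := ∑ k ∈ Finset.range (i + 1), E k with hP
  set Q := ∑ k ∈ Finset.Ico (i + 1) (d + 1), E k with hQ
  have hPQ : P + Q = 1 := by
    rw [hP, hQ, Finset.sum_range_add_sum_Ico _ (by omega), hsum]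
  have h1 : P * D * Q = E i * D * E (i + 1) := by
    rw [hP, hQ, Finset.sum_mul, Finset.sum_mul_sum, Finset.sum_eq_single i,
      Finset.sum_eq_single (i + 1)]
    · intro l hl hne
      rw [Finset.mem_Ico] at hl
      exact hD i l (by omega) (by omega) (by omega)
    · intro h
      exact absurd (Finset.mem_Ico.2 ⟨le_rfl, by omega⟩) h
    · intro k hk hne
      rw [Finset.mem_range] at hk
      refine Finset.sum_eq_zero fun l hl => ?_
      rw [Finset.mem_Ico] at hl
      exact hD k l (by omega) (by omega) (by omega)
    · intro h
      exact absurd (Finset.mem_range.2 (Nat.lt_succ_self i)) h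
  have h2 : Q * D * P = E (i + 1) * D * E i := by
    rw [hP, hQ, Finset.sum_mul, Finset.sum_mul_sum, Finset.sum_eq_single (i + 1),
      Finset.sum_eq_single i]
    · intro l hl hne
      rw [Finset.mem_range] at hl
      exact hD (i + 1) l (by omega) (by omega) (by omega)
    · intro h
      exact absurd (Finset.mem_range.2 (Nat.lt_succ_self i)) h
    · intro k hk hne
      rw [Finset.mem_Ico] at hk
      refine Finset.sum_eq_zero fun l hl => ?_
      rw [Finset.mem_range] at hl
      exact hD k l (by omega) (by omega) (by omega)
    · intro h
      exact absurd (Finset.mem_Ico.2 ⟨le_rfl, by omega⟩) h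
  have hQ' : Q = 1 - P := by rw [← hPQ]; abel
  rw [← h1, ← h2, hQ']
  noncomm_ring

/-- For a family of matrices `D w` tridiagonal with respect to `E 0, …, E d` and `F`, `H` in the
span of the `E i`, the matrix `F * D w * H - H * D w * F` is a commutator `Y * D w - D w * Y`
with `Y` independent of `w`. -/
theorem exists_skew_eq_commutator {ι : Type*} {d : ℕ} {E : ℕ → Matrix X X ℝ}
    {D : ι → Matrix X X ℝ} (hsum : ∑ i ∈ Finset.range (d + 1), E i = 1)
    (hD : ∀ w, ∀ i j : ℕ, i ≤ d → j ≤ d → (i + 1 < j ∨ j + 1 < i) → E i * D w * E j = 0)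
    {F H : Matrix X X ℝ} (hF : F ∈ Submodule.span ℝ (E '' Set.Iic d))
    (hH : H ∈ Submodule.span ℝ (E '' Set.Iic d)) :
    ∃ Y : Matrix X X ℝ, ∀ w, F * D w * H - H * D w * F = Y * D w - D w * Y := by
  induction hF using Submodule.span_induction with
  | zero => exact ⟨0, fun w => by simp⟩
  | add F₁ F₂ _ _ h₁ h₂ =>
    obtain ⟨Y₁, h₁⟩ := h₁
    obtain ⟨Y₂, h₂⟩ := h₂
    refine ⟨Y₁ + Y₂, fun w => ?_⟩
    have : (F₁ + F₂) * D w * H - H * D w * (F₁ + F₂) =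
        (F₁ * D w * H - H * D w * F₁) + (F₂ * D w * H - H * D w * F₂) := by noncomm_ring
    rw [this, h₁, h₂]
    noncomm_ring
  | smul r F _ h =>
    obtain ⟨Y, h⟩ := h
    refine ⟨r • Y, fun w => ?_⟩
    rw [smul_mul_assoc, smul_mul_assoc, mul_smul_comm, ← smul_sub, h w, smul_mul_assoc,
      mul_smul_comm, smul_sub]
  | mem F hF =>
    obtain ⟨i, hi, rfl⟩ := hF
    induction hH using Submodule.span_induction with
    | zero => exact ⟨0, fun w => by simp⟩
    | add H₁ H₂ _ _ h₁ h₂ =>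
      obtain ⟨Y₁, h₁⟩ := h₁
      obtain ⟨Y₂, h₂⟩ := h₂
      refine ⟨Y₁ + Y₂, fun w => ?_⟩
      have : E i * D w * (H₁ + H₂) - (H₁ + H₂) * D w * E i =
          (E i * D w * H₁ - H₁ * D w * E i) + (E i * D w * H₂ - H₂ * D w * E i) := by noncomm_ring
      rw [this, h₁, h₂]
      noncomm_ring
    | smul r H _ h =>
      obtain ⟨Y, h⟩ := h
      refine ⟨r • Y, fun w => ?_⟩
      rw [smul_mul_assoc, smul_mul_assoc, mul_smul_comm, ← smul_sub, h w, smul_mul_assoc,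
        mul_smul_comm, smul_sub]
    | mem H hH =>
      obtain ⟨j, hj, rfl⟩ := hH
      rw [Set.mem_Iic] at hi hj
      rcases eq_or_ne i j with rfl | hne
      · exact ⟨0, fun w => by simp⟩
      by_cases hij : j = i + 1
      · subst hij
        exact ⟨_, fun w => adjacent_skew_eq_commutator hsum (hD w) hj⟩
      by_cases hji : i = j + 1
      · subst hji
        refine ⟨-∑ k ∈ Finset.range (j + 1), E k, fun w => ?_⟩
        rw [← neg_sub, adjacent_skew_eq_commutator hsum (hD w) hi]
        noncomm_ring
      · refine ⟨0, fun w => ?_⟩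
        rw [hD w i j hi hj (by omega), hD w j i hj hi (by omega)]
        simp

end Idempotents

variable {Γ : DRG}

theorem Ai_transpose (i : ℕ) : (Γ.Ai i)ᵀ = Γ.Ai i := by
  ext x y
  simp [Ai, SimpleGraph.dist_comm]

theorem card_sphere_inter (x y : Γ.X) (i j : ℕ) :
    (Γ.sphere x i ∩ Γ.sphere y j).card = Γ.p (Γ.G.dist x y) i j := by
  rw [← Γ.dist_regular _ i j x y rfl, sphere, sphere, ← Finset.filter_and]

theorem n_ne_zero (x : Γ.X) : Γ.n ≠ 0 := by
  have : Nonempty Γ.X := ⟨x⟩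
  exact Nat.cast_ne_zero.2 Fintype.card_ne_zero

theorem IsDualEigs.apply {E : Matrix Γ.X Γ.X ℝ} {ts : ℤ → ℝ} (hts : Γ.IsDualEigs E ts)
    (x y : Γ.X) : E x y = (Γ.n)⁻¹ * ts (Γ.G.dist x y) := by
  rw [IsDualEigs] at hts
  rw [hts, Matrix.smul_apply, Matrix.sum_apply, smul_eq_mul,
    Finset.sum_eq_single (Γ.G.dist x y)]
  · simp [Ai]
  · intro i _ hi
    simp [Ai, hi.symm]
  · intro h
    exact absurd (Finset.mem_range.2 (Nat.lt_succ_of_le (Γ.dist_le x y))) h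

/-- The span of the `E i` is closed under the entrywise product. -/
theorem IsKrein.hadamard_mem {E : ℕ → Matrix Γ.X Γ.X ℝ} {q : ℕ → ℕ → ℕ → ℝ} (hq : Γ.IsKrein E q)
    {i : ℕ} (hi : i ≤ Γ.d) {F : Matrix Γ.X Γ.X ℝ}
    (hF : F ∈ Submodule.span ℝ (E '' Set.Iic Γ.d)) :
    Matrix.hadamard (E i) F ∈ Submodule.span ℝ (E '' Set.Iic Γ.d) := by
  induction hF using Submodule.span_induction with
  | zero => simp
  | add F₁ F₂ _ _ h₁ h₂ => rw [Matrix.hadamard_add]; exact add_mem h₁ h₂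
  | smul r F _ h => rw [Matrix.hadamard_smul]; exact Submodule.smul_mem _ _ h
  | mem F hF =>
    obtain ⟨j, hj, rfl⟩ := hF
    rw [hq i j hi hj]
    refine Submodule.smul_mem _ _ (Submodule.sum_mem _ fun h hh => Submodule.smul_mem _ _
      (Submodule.subset_span ⟨h, ?_, rfl⟩))
    simpa [Nat.lt_succ_iff] using hh

theorem polynomial_map_mem {E : ℕ → Matrix Γ.X Γ.X ℝ} {q : ℕ → ℕ → ℕ → ℝ} (hq : Γ.IsKrein E q)
    (hE0 : E 0 = (Γ.n)⁻¹ • Γ.Jmat) {i : ℕ} (hi : i ≤ Γ.d) (P : Polynomial ℝ) :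
    (E i).map (fun t => P.eval t) ∈ Submodule.span ℝ (E '' Set.Iic Γ.d) := by
  have hpow : ∀ m : ℕ, (E i).map (fun t => t ^ m) ∈ Submodule.span ℝ (E '' Set.Iic Γ.d) := by
    intro m
    induction m with
    | zero =>
      have h : (E i).map (fun t => t ^ 0) = Γ.n • E 0 := by
        ext x y
        simp [hE0, Jmat, n_ne_zero x]
      rw [h]
      exact Submodule.smul_mem _ _ (Submodule.subset_span ⟨0, by simp, rfl⟩)
    | succ m ih =>
      have h : (E i).map (fun t => t ^ (m + 1)) =
          Matrix.hadamard (E i) ((E i).map (fun t => t ^ m)) := by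
        ext x y
        simp [pow_succ']
      rw [h]
      exact hq.hadamard_mem hi ih
  have h : (E i).map (fun t => P.eval t) =
      ∑ m ∈ Finset.range (P.natDegree + 1), P.coeff m • (E i).map (fun t => t ^ m) := by
    ext x y
    simp [Matrix.sum_apply, Polynomial.eval_eq_sum_range]
  rw [h]
  exact Submodule.sum_mem _ fun m _ => Submodule.smul_mem _ _ (hpow m)

/-- Every distance matrix lies in the span of the `E i`. -/
theorem Ai_mem_span {E : ℕ → Matrix Γ.X Γ.X ℝ} {q : ℕ → ℕ → ℕ → ℝ} (hq : Γ.IsKrein E q)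
    (hE0 : E 0 = (Γ.n)⁻¹ • Γ.Jmat) {ts : ℤ → ℝ} (hts : Γ.IsDualEigs (E 1) ts)
    (hts' : Γ.DualDistinct ts) (j : ℕ) : Γ.Ai j ∈ Submodule.span ℝ (E '' Set.Iic Γ.d) := by
  have hd := Γ.d_ge_two
  by_cases hj : j ≤ Γ.d
  · have hinj : Set.InjOn (fun i : ℕ => (Γ.n)⁻¹ * ts i) (Finset.range (Γ.d + 1)) := by
      intro i hi k hk hik
      obtain ⟨x, _⟩ := Γ.dist_attained
      simp only [Finset.coe_range, Set.mem_Iio, Nat.lt_succ_iff] at hi hk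
      exact hts' i k hi hk (mul_left_cancel₀ (inv_ne_zero (n_ne_zero x)) hik)
    have h : Γ.Ai j = (E 1).map (fun t => (Lagrange.basis (Finset.range (Γ.d + 1))
        (fun i : ℕ => (Γ.n)⁻¹ * ts i) j).eval t) := by
      ext x y
      have hmem : Γ.G.dist x y ∈ Finset.range (Γ.d + 1) :=
        Finset.mem_range.2 (Nat.lt_succ_of_le (Γ.dist_le x y))
      rw [Matrix.map_apply, hts.apply]
      by_cases hxy : Γ.G.dist x y = j
      · subst hxy
        simpa [Ai] using (Lagrange.eval_basis_self hinj hmem).symm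
      · simpa [Ai, hxy] using (Lagrange.eval_basis_of_ne
          (v := fun i : ℕ => (Γ.n)⁻¹ * ts i) (Ne.symm hxy) hmem).symm
    rw [h]
    exact polynomial_map_mem hq hE0 (by omega) _
  · have h : Γ.Ai j = 0 := by
      ext x y
      have := Γ.dist_le x y
      simp only [Ai, Matrix.of_apply, Matrix.zero_apply, ite_eq_right_iff, one_ne_zero]
      omega
    rw [h]
    exact zero_mem _

/-- The vanishing of the Krein parameter `q 1 i j` implies the triple product relation
`E i * D * E j = 0`, with `D` a dual adjacency matrix. -/
theorem mul_diagonal_mul_eq_zero {E : ℕ → Matrix Γ.X Γ.X ℝ} {q : ℕ → ℕ → ℕ → ℝ}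
    (hq : Γ.IsKrein E q) (hsymm : ∀ k ≤ Γ.d, (E k)ᵀ = E k)
    (hmul : ∀ i j : ℕ, i ≤ Γ.d → j ≤ Γ.d → E i * E j = if i = j then E i else 0)
    {i j : ℕ} (hi : i ≤ Γ.d) (hj : j ≤ Γ.d) (hqij : q 1 i j = 0) (w : Γ.X) :
    E i * Matrix.diagonal (E 1 w) * E j = 0 := by
  have h1d : 1 ≤ Γ.d := by have := Γ.d_ge_two; omega
  have hHE : Matrix.hadamard (E i) (E j) * E 1 = 0 := by
    rw [hq i j hi hj, smul_mul_assoc, Finset.sum_mul, Finset.sum_eq_zero, smul_zero]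
    intro h hh
    rw [smul_mul_assoc, hmul h 1 (by simpa [Nat.lt_succ_iff] using hh) h1d]
    split_ifs with h1
    · rw [h1, hqij, zero_smul]
    · rw [smul_zero]
  rw [← Matrix.trace_mul_conjTranspose_self_eq_zero_iff,
    Matrix.conjTranspose_eq_transpose_of_trivial, Matrix.transpose_mul, Matrix.transpose_mul,
    Matrix.diagonal_transpose, hsymm i hi, hsymm j hj]
  have h1 : E i * Matrix.diagonal (E 1 w) * E j * (E j * (Matrix.diagonal (E 1 w) * E i)) =
      E i * (Matrix.diagonal (E 1 w) * (E j * E j) * (Matrix.diagonal (E 1 w) * E i)) := by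
    simp only [Matrix.mul_assoc]
  have h2 : Matrix.diagonal (E 1 w) * E j * (Matrix.diagonal (E 1 w) * E i) * E i =
      Matrix.diagonal (E 1 w) * E j * (Matrix.diagonal (E 1 w) * (E i * E i)) := by
    simp only [Matrix.mul_assoc]
  rw [h1, hmul j j hj hj, if_pos rfl, Matrix.trace_mul_comm, h2, hmul i i hi hi, if_pos rfl]
  have h3 : Matrix.trace (Matrix.diagonal (E 1 w) * E j * (Matrix.diagonal (E 1 w) * E i)) =
      ∑ x, E 1 w x * (Matrix.hadamard (E i) (E j) * E 1) x w := by
    simp only [Matrix.trace, Matrix.diag_apply]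
    refine Finset.sum_congr rfl fun x _ => ?_
    rw [Matrix.mul_apply, Matrix.mul_apply, Finset.mul_sum]
    refine Finset.sum_congr rfl fun y _ => ?_
    rw [Matrix.diagonal_mul, Matrix.diagonal_mul, Matrix.hadamard_apply,
      ← congrFun₂ (hsymm i hi) x y, ← congrFun₂ (hsymm 1 h1d) y w, Matrix.transpose_apply,
      Matrix.transpose_apply]
    ring
  rw [h3, hHE]
  simp

theorem mulVec_sum_hatv (E : Matrix Γ.X Γ.X ℝ) (s : Finset Γ.X) (w : Γ.X) :
    (E *ᵥ ∑ z ∈ s, Γ.hatv z) w = ∑ z ∈ s, E w z := by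
  simp [Matrix.mulVec_sum, hatv, Finset.sum_apply]

theorem Ai_mul_diagonal_mul_Ai_apply (v : Γ.X → ℝ) (i j : ℕ) (x y : Γ.X) :
    (Γ.Ai i * Matrix.diagonal v * Γ.Ai j) x y = ∑ z ∈ Γ.sphere x i ∩ Γ.sphere y j, v z := by
  rw [sphere, sphere, ← Finset.filter_and, Finset.sum_filter, Matrix.mul_apply]
  refine Finset.sum_congr rfl fun z _ => ?_
  rw [Matrix.mul_diagonal, ite_and]
  simp only [Ai, Matrix.of_apply, SimpleGraph.dist_comm (u := z) (v := y)]
  split_ifs <;> simp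

/-- The balanced set condition. -/
theorem balanced_set {E : ℕ → Matrix Γ.X Γ.X ℝ} {θ : ℕ → ℝ} (hE : Γ.IsPrimIdemSeq E θ)
    {q : ℕ → ℕ → ℕ → ℝ} (hq : Γ.IsKrein E q) (hQ : Γ.IsQPolynomial q) {ts : ℤ → ℝ}
    (hts : Γ.IsDualEigs (E 1) ts) (hts' : Γ.DualDistinct ts) {x y : Γ.X} (hxy : x ≠ y)
    (i j : ℕ) (w : Γ.X) :
    ∑ z ∈ Γ.sphere x i ∩ Γ.sphere y j, E 1 w z - ∑ z ∈ Γ.sphere y i ∩ Γ.sphere x j, E 1 w z =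
      (Γ.p (Γ.G.dist x y) i j * ((ts i - ts j) / (ts 0 - ts (Γ.G.dist x y)))) *
        (E 1 w x - E 1 w y) := by
  obtain ⟨hE0, hsum, hmul, hA, hθ⟩ := hE
  have h1d : 1 ≤ Γ.d := by have := Γ.d_ge_two; omega
  have hsymm : ∀ k ≤ Γ.d, (E k)ᵀ = E k := fun k hk =>
    transpose_eq_self_of_eigen (Ai_transpose 1) hsum hmul hA hθ hk
  obtain ⟨Y, hY⟩ := exists_skew_eq_commutator (D := fun w => Matrix.diagonal (E 1 w)) hsum
    (fun w k l hk hl hkl => mul_diagonal_mul_eq_zero hq hsymm hmul hk hl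
      ((hQ 1 k l h1d hk hl).1 (by omega)) w)
    (Ai_mem_span hq hE0 hts hts' i) (Ai_mem_span hq hE0 hts hts' j)
  have hbal : ∀ w, ∑ z ∈ Γ.sphere x i ∩ Γ.sphere y j, E 1 w z -
      ∑ z ∈ Γ.sphere y i ∩ Γ.sphere x j, E 1 w z = Y x y * (E 1 w y - E 1 w x) := by
    intro w
    have h := congrFun₂ (hY w) x y
    rw [Matrix.sub_apply, Matrix.sub_apply, Ai_mul_diagonal_mul_Ai_apply,
      Ai_mul_diagonal_mul_Ai_apply, Matrix.mul_diagonal, Matrix.diagonal_mul] at h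
    rw [Finset.inter_comm (Γ.sphere y i), h]
    ring
  have hsum1 : ∑ z ∈ Γ.sphere x i ∩ Γ.sphere y j, E 1 x z =
      Γ.p (Γ.G.dist x y) i j * ((Γ.n)⁻¹ * ts i) := by
    rw [← card_sphere_inter, ← nsmul_eq_mul]
    refine Finset.sum_eq_card_nsmul fun z hz => ?_
    simp only [sphere, Finset.mem_inter, Finset.mem_filter] at hz
    rw [hts.apply, hz.1.2]
  have hsum2 : ∑ z ∈ Γ.sphere y i ∩ Γ.sphere x j, E 1 x z =
      Γ.p (Γ.G.dist x y) i j * ((Γ.n)⁻¹ * ts j) := by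
    rw [SimpleGraph.dist_comm, ← card_sphere_inter, ← nsmul_eq_mul]
    refine Finset.sum_eq_card_nsmul fun z hz => ?_
    simp only [sphere, Finset.mem_inter, Finset.mem_filter] at hz
    rw [hts.apply, hz.2.2]
  have hne : ts 0 - ts (Γ.G.dist x y) ≠ 0 := by
    intro h
    have := hts' 0 _ (Nat.zero_le _) (Γ.dist_le x y) (by simpa using sub_eq_zero.1 h)
    exact hxy (Γ.conn.dist_eq_zero_iff.1 this.symm)
  have hx := hbal x
  rw [hsum1, hsum2, hts.apply, hts.apply, SimpleGraph.dist_self, Nat.cast_zero] at hx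
  have hn := inv_ne_zero (n_ne_zero x)
  have hYxy : Y x y * (ts 0 - ts (Γ.G.dist x y)) =
      -(Γ.p (Γ.G.dist x y) i j * (ts i - ts j)) := by
    refine mul_left_cancel₀ hn ?_
    linear_combination hx
  rw [hbal w, ← mul_div_assoc, ← neg_neg (_ * (ts i - ts j)), ← hYxy, neg_div,
    mul_div_cancel_right₀ _ hne]
  ring

end DRG

/-- Corollary 4.2: `C(x,y) = C(y,x)` and `B(x,y) = B(y,x)`. -/
theorem DRG.Cvec_Bvec_symm (Γ : DRG) (E : ℕ → Matrix Γ.X Γ.X ℝ) (θ : ℕ → ℝ)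
    (hE : Γ.IsPrimIdemSeq E θ)
    (q : ℕ → ℕ → ℕ → ℝ) (hq : Γ.IsKrein E q) (hQ : Γ.IsQPolynomial q)
    (ts : ℤ → ℝ) (hts : Γ.IsDualEigs (E 1) ts) (hts' : Γ.DualDistinct ts) (x y : Γ.X)
    (hxy : x ≠ y) :
    Γ.Cvec (E 1) ts x y = Γ.Cvec (E 1) ts y x ∧
    Γ.Bvec (E 1) ts x y = Γ.Bvec (E 1) ts y x := by
  have hpos : 1 ≤ Γ.G.dist x y := Γ.conn.pos_dist_of_ne hxy
  constructor
  · ext w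
    have h := DRG.balanced_set hE hq hQ hts hts' hxy 1 (Γ.G.dist x y - 1) w
    rw [Nat.cast_sub hpos, Nat.cast_one] at h
    simp only [DRG.Cvec, DRG.minusv, DRG.c, Pi.sub_apply, Pi.smul_apply, smul_eq_mul,
      DRG.mulVec_sum_hatv, SimpleGraph.dist_comm (u := y) (v := x)]
    simp only [DRG.hatv, Matrix.mulVec_single_one, Matrix.col_apply]
    linear_combination h
  · ext w
    have h := DRG.balanced_set hE hq hQ hts hts' hxy 1 (Γ.G.dist x y + 1) w
    rw [Nat.cast_add, Nat.cast_one] at h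
    simp only [DRG.Bvec, DRG.plusv, DRG.b, Pi.sub_apply, Pi.smul_apply, smul_eq_mul,
      DRG.mulVec_sum_hatv, SimpleGraph.dist_comm (u := y) (v := x)]
    simp only [DRG.hatv, Matrix.mulVec_single_one, Matrix.col_apply]
    linear_combination h
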